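/- arXiv:2105.09715 — 2 statements merged into one kernel-verified Lean document; each statement's English description precedes it below -/
import Mathlib

section
/- For every A ∈ B(H), w(A)² ≥ (1/4)‖A*A + AA*‖ + (1/2)|‖Re(A)‖² − ‖Im(A)‖²|. -/
open ContinuousLinearMap Filter
open scoped ComplexInnerProductSpace Topology

variable {H : Type*} [NormedAddCommGroup H] [InnerProductSpace ℂ H]
  [CompleteSpace H] [Nontrivial H]

/-- The numerical range of a bounded linear operator. -/
noncomputable def numRange (A : H →L[ℂ] H) : Set ℂ :=
  {z : ℂ | ∃ x : H, ‖x‖ = 1 ∧ z = ⟪x, A x⟫}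

/-- The numerical radius of a bounded linear operator. -/
noncomputable def numRadius (A : H →L[ℂ] H) : ℝ :=
  sSup {r : ℝ | ∃ x : H, ‖x‖ = 1 ∧ r = ‖(⟪x, A x⟫)‖}

/-- The Crawford number of a bounded linear operator. -/
noncomputable def crawford (A : H →L[ℂ] H) : ℝ :=
  sInf {r : ℝ | ∃ x : H, ‖x‖ = 1 ∧ r = ‖(⟪x, A x⟫)‖}

/-- The real part `(A + A*)/2` of a bounded linear operator. -/
noncomputable def reOp (A : H →L[ℂ] H) : H →L[ℂ] H :=
  (2 : ℂ)⁻¹ • (A + ContinuousLinearMap.adjoint A)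

/-- The imaginary part `(A - A*)/(2i)` of a bounded linear operator. -/
noncomputable def imOp (A : H →L[ℂ] H) : H →L[ℂ] H :=
  (2 * Complex.I)⁻¹ • (A - ContinuousLinearMap.adjoint A)

lemma norm_inner_apply_le_numRadius {E : Type*} [NormedAddCommGroup E]
    [InnerProductSpace ℂ E] (A : E →L[ℂ] E) (x : E) :
    ‖(⟪x, A x⟫)‖ ≤ numRadius A * ‖x‖ ^ 2 := by
  by_cases hx : x = 0
  · simp [hx]
  have hx' : 0 < ‖x‖ := norm_pos_iff.mpr hx
  have hbdd : BddAbove {r : ℝ | ∃ x : E, ‖x‖ = 1 ∧ r = ‖(⟪x, A x⟫)‖} := by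
    refine ⟨‖A‖, ?_⟩
    rintro _ ⟨y, hy, rfl⟩
    calc ‖(⟪y, A y⟫)‖ ≤ ‖y‖ * ‖A y‖ := norm_inner_le_norm y (A y)
      _ ≤ ‖A‖ := by simpa [hy] using A.le_opNorm y
  have hmem := le_csSup hbdd
    ⟨((‖x‖⁻¹ : ℝ) : ℂ) • x, by simp [norm_smul, hx'.ne'], rfl⟩
  rw [map_smul, inner_smul_left, inner_smul_right] at hmem
  simp only [norm_mul, Complex.norm_conj, Complex.norm_real, norm_inv, norm_norm] at hmem
  change _ ≤ numRadius A at hmem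
  rw [← mul_assoc, ← mul_inv, inv_mul_le_iff₀ (by positivity)] at hmem
  linarith

lemma norm_le_numRadius_of_abs_re_inner_le {A T : H →L[ℂ] H} (hT : IsSelfAdjoint T)
    (h : ∀ x : H, |(⟪T x, x⟫).re| ≤ ‖(⟪x, A x⟫)‖) : ‖T‖ ≤ numRadius A := by
  rw [T.norm_eq_iSup_rayleighQuotient hT.isSymmetric]
  refine ciSup_le fun x ↦ ?_
  have hnonneg : 0 ≤ numRadius A := by
    obtain ⟨y, hy⟩ := exists_ne (0 : H)
    exact nonneg_of_mul_nonneg_left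
      ((norm_nonneg _).trans (norm_inner_apply_le_numRadius A y)) (by positivity)
  rw [rayleighQuotient, abs_div, abs_of_nonneg (sq_nonneg ‖x‖)]
  exact div_le_of_le_mul₀ (sq_nonneg _) hnonneg
    ((h x).trans (norm_inner_apply_le_numRadius A x))

lemma isSelfAdjoint_reOp {E : Type*} [NormedAddCommGroup E]
    [InnerProductSpace ℂ E] [CompleteSpace E] (A : E →L[ℂ] E) : IsSelfAdjoint (reOp A) := by
  rw [isSelfAdjoint_iff', reOp]
  simp only [map_smulₛₗ, map_add, adjoint_adjoint, map_inv₀, Complex.conj_ofNat, add_comm]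

lemma isSelfAdjoint_imOp {E : Type*} [NormedAddCommGroup E]
    [InnerProductSpace ℂ E] [CompleteSpace E] (A : E →L[ℂ] E) : IsSelfAdjoint (imOp A) := by
  rw [isSelfAdjoint_iff', imOp]
  simp only [map_smulₛₗ, map_sub, adjoint_adjoint, map_inv₀, map_mul, Complex.conj_I,
    Complex.conj_ofNat, mul_neg, inv_neg, neg_smul, ← smul_neg, neg_sub]

lemma norm_reOp_le_numRadius (A : H →L[ℂ] H) : ‖reOp A‖ ≤ numRadius A := by
  refine norm_le_numRadius_of_abs_re_inner_le (isSelfAdjoint_reOp A) fun x ↦ ?_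
  have h : (⟪reOp A x, x⟫).re = (⟪x, A x⟫).re := by
    have hsymm : (⟪A x, x⟫).re = (⟪x, A x⟫).re := inner_re_symm (𝕜 := ℂ) _ _
    simp only [reOp, smul_apply, add_apply, inner_smul_left, inner_add_left,
      adjoint_inner_left]
    simp [hsymm]
    ring
  rw [h]
  exact Complex.abs_re_le_norm _

lemma norm_imOp_le_numRadius (A : H →L[ℂ] H) : ‖imOp A‖ ≤ numRadius A := by
  refine norm_le_numRadius_of_abs_re_inner_le (isSelfAdjoint_imOp A) fun x ↦ ?_
  have h : (⟪imOp A x, x⟫).re = (⟪x, A x⟫).im := by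
    have hsymm : (⟪A x, x⟫).im = -(⟪x, A x⟫).im := inner_im_symm (𝕜 := ℂ) _ _
    simp only [imOp, smul_apply, sub_apply, inner_smul_left, inner_sub_left,
      adjoint_inner_left]
    simp [hsymm]
    ring
  rw [h]
  exact Complex.abs_im_le_norm _

lemma adjoint_comp_add_comp_adjoint {E : Type*} [NormedAddCommGroup E]
    [InnerProductSpace ℂ E] [CompleteSpace E] (A : E →L[ℂ] E) :
    adjoint A ∘L A + A ∘L adjoint A =
      (2 : ℂ) • (reOp A ∘L reOp A + imOp A ∘L imOp A) := by
  have hI : (2 * Complex.I)⁻¹ * (2 * Complex.I)⁻¹ = -(4 : ℂ)⁻¹ := by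
    rw [← mul_inv, mul_mul_mul_comm, Complex.I_mul_I]
    norm_num
  simp only [reOp, imOp, smul_comp, comp_smul, smul_sub, smul_smul, hI, add_comp, comp_add, sub_comp,
    comp_sub]
  module

lemma norm_adjoint_comp_add_comp_adjoint_le {E : Type*} [NormedAddCommGroup E]
    [InnerProductSpace ℂ E] [CompleteSpace E] (A : E →L[ℂ] E) :
    ‖adjoint A ∘L A + A ∘L adjoint A‖ ≤ 2 * (‖reOp A‖ ^ 2 + ‖imOp A‖ ^ 2) := by
  rw [adjoint_comp_add_comp_adjoint, norm_smul, Complex.norm_ofNat]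
  gcongr
  refine (norm_add_le _ _).trans ?_
  rw [sq, sq]
  exact add_le_add (opNorm_comp_le _ _) (opNorm_comp_le _ _)

/-- For every `A ∈ B(H)`,
`w(A)² ≥ (1/4)‖A*A + AA*‖ + (1/2)|‖Re(A)‖² − ‖Im(A)‖²|`. -/
theorem stmt7 (A : H →L[ℂ] H) :
    numRadius A ^ 2 ≥ (1 / 4) * ‖adjoint A ∘L A + A ∘L adjoint A‖ +
      (1 / 2) * |‖reOp A‖ ^ 2 - ‖imOp A‖ ^ 2| := by
  have hnorm := norm_adjoint_comp_add_comp_adjoint_le A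
  have hre := pow_le_pow_left₀ (norm_nonneg _) (norm_reOp_le_numRadius A) 2
  have him := pow_le_pow_left₀ (norm_nonneg _) (norm_imOp_le_numRadius A) 2
  rcases abs_cases (‖reOp A‖ ^ 2 - ‖imOp A‖ ^ 2) with ⟨h, -⟩ | ⟨h, -⟩ <;>
    rw [h] <;> linarith
end

section
/- Let A ∈ B(H). If w(A) = (1/2)√(‖A*A + AA*‖), then c(Re(A)) = 0 and c(Im(A)) = 0; in particular there exist sequences of unit vectors (x_n) and (y_n) in H with |⟨Re(A)x_n, x_n⟩| → 0 and |⟨Im(A)y_n, y_n⟩| → 0. -/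
open ContinuousLinearMap Filter
open scoped ComplexInnerProductSpace Topology

variable {H : Type*} [NormedAddCommGroup H] [InnerProductSpace ℂ H]
  [CompleteSpace H] [Nontrivial H]

section Helpers

variable {E : Type*} [NormedAddCommGroup E] [InnerProductSpace ℂ E]

lemma norm_le_of_abs_re_inner_le [Nontrivial E] {T : E →L[ℂ] E}
    (hT : (T : E →ₗ[ℂ] E).IsSymmetric) {M : ℝ}
    (hM : ∀ x : E, ‖x‖ = 1 → |(⟪x, T x⟫).re| ≤ M) : ‖T‖ ≤ M := by
  have hM0 : 0 ≤ M := by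
    obtain ⟨x, hx⟩ := exists_norm_eq E zero_le_one
    exact (abs_nonneg _).trans (hM x hx)
  rw [norm_eq_iSup_rayleighQuotient T hT]
  refine ciSup_le fun x => ?_
  rcases eq_or_ne x 0 with rfl | hx
  · simpa using hM0
  · have hx' : (‖x‖ : ℂ) ≠ 0 := by simpa using hx
    have hn : ‖(‖x‖ : ℂ)⁻¹ • x‖ = 1 := by
      rw [norm_smul, norm_inv, Complex.norm_real, norm_norm, inv_mul_cancel₀ (norm_ne_zero_iff.2 hx)]
    rw [← rayleigh_smul T x (inv_ne_zero hx'), rayleighQuotient, hn, reApplyInnerSelf_apply,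
      inner_re_symm]
    rw [one_pow, div_one]
    exact hM _ hn

lemma tendsto_apply_apply_sub_smul {T : E →L[ℂ] E} (hT : (T : E →ₗ[ℂ] E).IsSymmetric) {s : ℝ}
    (hs : ‖T‖ ≤ s) {x : ℕ → E} (hx : ∀ n, ‖x n‖ = 1)
    (hlim : Tendsto (fun n => ‖T (x n)‖ ^ 2) atTop (𝓝 (s ^ 2))) :
    Tendsto (fun n => T (T (x n)) - ((s ^ 2 : ℝ) : ℂ) • x n) atTop (𝓝 0) := by
  rw [tendsto_zero_iff_norm_tendsto_zero]
  have hsq : Tendsto (fun n => ‖T (T (x n)) - ((s ^ 2 : ℝ) : ℂ) • x n‖ ^ 2) atTop (𝓝 0) := by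
    have hbound : Tendsto (fun n => s ^ 2 * (s ^ 2 - ‖T (x n)‖ ^ 2)) atTop (𝓝 0) := by
      have := (hlim.const_sub (s ^ 2)).const_mul (s ^ 2)
      rwa [sub_self, mul_zero] at this
    refine squeeze_zero (fun n => sq_nonneg _) (fun n => ?_) hbound
    have hre : (⟪T (T (x n)), x n⟫).re = ‖T (x n)‖ ^ 2 := by
      have := hT (T (x n)) (x n)
      simp only [coe_coe] at this
      rw [this]
      exact inner_self_eq_norm_sq (𝕜 := ℂ) (T (x n))
    have hTT : ‖T (T (x n))‖ ≤ s * ‖T (x n)‖ := T.le_of_opNorm_le hs _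
    have hTT2 : ‖T (T (x n))‖ ^ 2 ≤ s ^ 2 * ‖T (x n)‖ ^ 2 := by
      rw [← mul_pow]; gcongr
    have hsm : ‖((s ^ 2 : ℝ) : ℂ) • x n‖ = s ^ 2 := by
      rw [norm_smul, hx, mul_one, Complex.norm_real, Real.norm_of_nonneg (sq_nonneg s)]
    rw [norm_sub_sq (𝕜 := ℂ), hsm, inner_smul_right]
    simp only [RCLike.re_to_complex, Complex.re_ofReal_mul, hre]
    nlinarith
  have := hsq.sqrt
  simpa [Real.sqrt_sq (norm_nonneg _)] using this

lemma tendsto_zero_of_apply_add_smul {T : E →L[ℂ] E} (hT : ∀ x, 0 ≤ (⟪x, T x⟫).re) {w : ℝ}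
    (hw : 0 < w) {u : ℕ → E}
    (hu : Tendsto (fun n => T (u n) + (w : ℂ) • u n) atTop (𝓝 0)) :
    Tendsto u atTop (𝓝 0) := by
  rw [tendsto_zero_iff_norm_tendsto_zero] at hu ⊢
  have hb : Tendsto (fun n => w⁻¹ * ‖T (u n) + (w : ℂ) • u n‖) atTop (𝓝 0) := by
    simpa using hu.const_mul w⁻¹
  refine squeeze_zero (fun n => norm_nonneg _) (fun n => ?_) hb
  rw [le_inv_mul_iff₀ hw]
  have h1 : w * ‖u n‖ ^ 2 ≤ (⟪u n, T (u n) + (w : ℂ) • u n⟫).re := by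
    rw [inner_add_right, inner_smul_right, inner_self_eq_norm_sq_to_K]
    have : (((w : ℂ) * ((‖u n‖ : ℝ) : ℂ) ^ 2)).re = w * ‖u n‖ ^ 2 := by
      rw [← Complex.ofReal_pow, ← Complex.ofReal_mul, Complex.ofReal_re]
    rw [Complex.add_re]
    simp only [Complex.coe_algebraMap]
    rw [this]
    linarith [hT (u n)]
  have h2 : (⟪u n, T (u n) + (w : ℂ) • u n⟫).re ≤ ‖u n‖ * ‖T (u n) + (w : ℂ) • u n‖ :=
    re_inner_le_norm (𝕜 := ℂ) _ _
  rcases (norm_nonneg (u n)).eq_or_lt with h0 | h0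
  · rw [← h0, mul_zero]; exact norm_nonneg _
  · nlinarith

/-- An extremal pair of symmetric operators: `B` cannot be positive. -/
lemma exists_re_inner_neg {B C : E →L[ℂ] E} (hB : (B : E →ₗ[ℂ] E).IsSymmetric)
    (hC : (C : E →ₗ[ℂ] E).IsSymmetric) {w s : ℝ} (hw : 0 < w) (hs : s ^ 2 = 2 * w ^ 2)
    (hBw : ‖B‖ ≤ w) (hCw : ‖C‖ ≤ w) (hadd : ‖B + C‖ ≤ s) (hsub : ‖B - C‖ ≤ s)
    {x : ℕ → E} (hx : ∀ n, ‖x n‖ = 1)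
    (hlim : Tendsto (fun n => ‖B (x n)‖ ^ 2 + ‖C (x n)‖ ^ 2) atTop (𝓝 (2 * w ^ 2))) :
    ∃ z : E, (⟪z, B z⟫).re < 0 := by
  by_contra! hpos
  have bound {T : E →L[ℂ] E} {r : ℝ} (hT : ‖T‖ ≤ r) (n : ℕ) : ‖T (x n)‖ ^ 2 ≤ r ^ 2 := by
    have := T.le_of_opNorm_le hT (x n)
    rw [hx, mul_one] at this
    gcongr
  have hlimB : Tendsto (fun n => ‖B (x n)‖ ^ 2) atTop (𝓝 (w ^ 2)) := by
    refine tendsto_of_tendsto_of_tendsto_of_le_of_le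
      (g := fun n => ‖B (x n)‖ ^ 2 + ‖C (x n)‖ ^ 2 - w ^ 2) ?_ tendsto_const_nhds
      (fun n => ?_) (bound hBw)
    · convert hlim.sub_const (w ^ 2) using 2; ring
    · have := bound hCw n
      dsimp only; linarith
  have hlimC : Tendsto (fun n => ‖C (x n)‖ ^ 2) atTop (𝓝 (w ^ 2)) := by
    convert hlim.sub hlimB using 2 <;> ring
  have hlimD : Tendsto (fun n => ‖(B + C) (x n)‖ ^ 2) atTop (𝓝 (s ^ 2)) := by
    refine tendsto_of_tendsto_of_tendsto_of_le_of_le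
      (g := fun n => 2 * (‖B (x n)‖ ^ 2 + ‖C (x n)‖ ^ 2) - s ^ 2) ?_ tendsto_const_nhds
      (fun n => ?_) (bound hadd)
    · convert (hlim.const_mul 2).sub_const (s ^ 2) using 2; rw [hs]; ring
    · have h1 := bound hsub n
      have h2 := parallelogram_law_with_norm ℂ (B (x n)) (C (x n))
      rw [sub_apply] at h1
      rw [add_apply]
      nlinarith
  have hBB := tendsto_apply_apply_sub_smul hB hBw hx hlimB
  have hCC := tendsto_apply_apply_sub_smul hC hCw hx hlimC
  have hDD := tendsto_apply_apply_sub_smul (hB.add hC) hadd hx hlimD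
  have hu : Tendsto (fun n => B (x n) - (w : ℂ) • x n) atTop (𝓝 0) := by
    refine tendsto_zero_of_apply_add_smul hpos hw ?_
    convert hBB using 2 with n
    simp only [map_sub, map_smul, Complex.ofReal_pow]
    module
  have hCx : Tendsto (fun n => C (x n)) atTop (𝓝 0) := by
    refine tendsto_zero_of_apply_add_smul hpos hw ?_
    have h1 := ((hDD.sub hBB).sub hCC).sub ((C.continuous.tendsto 0).comp hu)
    simp only [map_zero, sub_zero] at h1
    convert h1 using 2 with n
    simp only [add_apply, map_add, map_sub, map_smul, Function.comp_apply, hs,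
      Complex.ofReal_pow, Complex.ofReal_mul, Complex.ofReal_ofNat]
    module
  have h0 : Tendsto (fun n => ‖C (x n)‖ ^ 2) atTop (𝓝 0) := by
    simpa using hCx.norm.pow 2
  have := tendsto_nhds_unique hlimC h0
  exact (pow_pos hw 2).ne' this

lemma exists_unit_inner_eq_zero {T : E →L[ℂ] E} (hT : (T : E →ₗ[ℂ] E).IsSymmetric) {a b : E}
    (ha : (⟪a, T a⟫).re < 0) (hb : 0 < (⟪b, T b⟫).re) :
    ∃ z : E, ‖z‖ = 1 ∧ ⟪z, T z⟫ = 0 := by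
  have key : ∃ z : E, z ≠ 0 ∧ ⟪z, T z⟫ = 0 := by
    let p : ℝ → E := fun t => ((1 - t : ℝ) : ℂ) • a + (t : ℂ) • b
    have hp : Continuous fun t => (⟪p t, T (p t)⟫).re := by
      dsimp only [p]; fun_prop
    obtain ⟨t, -, ht⟩ : (0 : ℝ) ∈ (fun t => (⟪p t, T (p t)⟫).re) '' Set.Icc 0 1 := by
      refine intermediate_value_Icc zero_le_one hp.continuousOn ⟨?_, ?_⟩
      · simpa [p] using ha.le
      · simpa [p] using hb.le
    refine ⟨p t, fun h0 => ?_, ?_⟩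
    · have hsm (r : ℝ) (v : E) : (⟪(r : ℂ) • v, T ((r : ℂ) • v)⟫).re = r ^ 2 * (⟪v, T v⟫).re := by
        rw [map_smul, inner_smul_left, inner_smul_right, Complex.conj_ofReal,
          Complex.re_ofReal_mul, Complex.re_ofReal_mul]
        ring
      have hab : ((1 - t : ℝ) : ℂ) • a = ((-t : ℝ) : ℂ) • b := by
        rw [Complex.ofReal_neg, neg_smul]; exact eq_neg_of_add_eq_zero_left h0
      have h1 := hsm (1 - t) a
      rw [hab, hsm (-t) b] at h1
      have h2 : 0 ≤ (-t) ^ 2 * (⟪b, T b⟫).re := by positivity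
      have h3 : (1 - t) ^ 2 = 0 := by nlinarith [sq_nonneg (1 - t)]
      have h4 : t = 1 := by nlinarith
      rw [h4] at h1
      norm_num at h1
      exact hb.ne' h1
    · refine Complex.ext ht ?_
      exact hT.im_inner_self_apply (p t)
  obtain ⟨z, hz, hz0⟩ := key
  refine ⟨(‖z‖ : ℂ)⁻¹ • z, ?_, ?_⟩
  · rw [norm_smul, norm_inv, Complex.norm_real, norm_norm, inv_mul_cancel₀ (norm_ne_zero_iff.2 hz)]
  · rw [map_smul, inner_smul_left, inner_smul_right, hz0, mul_zero, mul_zero]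

lemma exists_unit_inner_eq_zero_of_extremal {B C : E →L[ℂ] E}
    (hB : (B : E →ₗ[ℂ] E).IsSymmetric)
    (hC : (C : E →ₗ[ℂ] E).IsSymmetric) {w s : ℝ} (hw : 0 < w) (hs : s ^ 2 = 2 * w ^ 2)
    (hBw : ‖B‖ ≤ w) (hCw : ‖C‖ ≤ w) (hadd : ‖B + C‖ ≤ s) (hsub : ‖B - C‖ ≤ s)
    {x : ℕ → E} (hx : ∀ n, ‖x n‖ = 1)
    (hlim : Tendsto (fun n => ‖B (x n)‖ ^ 2 + ‖C (x n)‖ ^ 2) atTop (𝓝 (2 * w ^ 2))) :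
    ∃ z : E, ‖z‖ = 1 ∧ ⟪z, B z⟫ = 0 := by
  obtain ⟨a, ha⟩ := exists_re_inner_neg hB hC hw hs hBw hCw hadd hsub hx hlim
  have hB' : ((-B : E →L[ℂ] E) : E →ₗ[ℂ] E).IsSymmetric := fun u v => by
    simpa using hB u v
  obtain ⟨b, hb⟩ := exists_re_inner_neg hB' hC hw hs (by rwa [norm_neg]) hCw
    (by rwa [neg_add_eq_sub, norm_sub_rev]) (by rwa [← neg_add', norm_neg]) hx
    (by simpa using hlim)
  exact exists_unit_inner_eq_zero hB ha (by simpa using hb)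

lemma norm_inner_le_numRadius (A : E →L[ℂ] E) {x : E} (hx : ‖x‖ = 1) :
    ‖(⟪x, A x⟫ : ℂ)‖ ≤ numRadius A := by
  refine le_csSup ⟨‖A‖, ?_⟩ ⟨x, hx, rfl⟩
  rintro r ⟨y, hy, rfl⟩
  calc ‖(⟪y, A y⟫ : ℂ)‖ ≤ ‖y‖ * ‖A y‖ := norm_inner_le_norm _ _
    _ ≤ ‖y‖ * (‖A‖ * ‖y‖) := by gcongr; exact A.le_opNorm y
    _ = ‖A‖ := by rw [hy]; ring

lemma crawford_eq_zero {A : E →L[ℂ] E} {x : E} (hx : ‖x‖ = 1) (h0 : ⟪x, A x⟫ = 0) :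
    crawford A = 0 := by
  refine IsLeast.csInf_eq ⟨⟨x, hx, by rw [h0, norm_zero]⟩, ?_⟩
  rintro r ⟨y, -, rfl⟩
  exact norm_nonneg _

variable [CompleteSpace E]

lemma isSymmetric_reOp (A : E →L[ℂ] E) : (reOp A : E →ₗ[ℂ] E).IsSymmetric := fun x y => by
  simp [reOp, inner_smul_left, inner_smul_right, inner_add_left, inner_add_right,
    adjoint_inner_left, adjoint_inner_right, Complex.conj_ofNat, add_comm]

lemma isSymmetric_imOp (A : E →L[ℂ] E) : (imOp A : E →ₗ[ℂ] E).IsSymmetric := fun x y => by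
  simp [imOp, inner_smul_left, inner_smul_right, inner_sub_left, inner_sub_right,
    adjoint_inner_left, adjoint_inner_right, Complex.conj_ofNat]
  ring

lemma reOp_add_I_smul_imOp (A : E →L[ℂ] E) : reOp A + Complex.I • imOp A = A := by
  have hI : Complex.I * (2 * Complex.I)⁻¹ = 2⁻¹ := by
    field_simp
  rw [reOp, imOp, smul_smul, hI]
  module

lemma inner_apply_eq (A : E →L[ℂ] E) (x : E) :
    ⟪x, A x⟫ = ⟪x, reOp A x⟫ + Complex.I * ⟪x, imOp A x⟫ := by
  conv_lhs => rw [← reOp_add_I_smul_imOp A]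
  rw [add_apply, smul_apply, inner_add_right, inner_smul_right]

lemma re_inner_reOp (A : E →L[ℂ] E) (x : E) : (⟪x, reOp A x⟫).re = (⟪x, A x⟫).re := by
  have := (isSymmetric_imOp A).im_inner_self_apply x
  simp only [coe_coe, RCLike.im_to_complex] at this
  simp [inner_apply_eq A x, this]

lemma re_inner_imOp (A : E →L[ℂ] E) (x : E) : (⟪x, imOp A x⟫).re = (⟪x, A x⟫).im := by
  have := (isSymmetric_reOp A).im_inner_self_apply x
  simp only [coe_coe, RCLike.im_to_complex] at this
  simp [inner_apply_eq A x, this]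

lemma re_inner_adjoint_comp_add_comp_adjoint (A : E →L[ℂ] E) (x : E) :
    (⟪x, (adjoint A ∘L A + A ∘L adjoint A) x⟫).re
      = 2 * (‖reOp A x‖ ^ 2 + ‖imOp A x‖ ^ 2) := by
  have h1 : A x = reOp A x + Complex.I • imOp A x := by
    conv_lhs => rw [← reOp_add_I_smul_imOp A]
    rfl
  have h2 : adjoint A x = reOp A x - Complex.I • imOp A x := by
    have hI : Complex.I * (2 * Complex.I)⁻¹ = 2⁻¹ := by
      field_simp
    simp only [reOp, imOp, smul_apply, smul_smul, hI, add_apply, sub_apply]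
    module
  have h3 : (⟪x, (adjoint A ∘L A + A ∘L adjoint A) x⟫).re = ‖A x‖ ^ 2 + ‖adjoint A x‖ ^ 2 := by
    have e1 := inner_self_eq_norm_sq (𝕜 := ℂ) (A x)
    have e2 := inner_self_eq_norm_sq (𝕜 := ℂ) (adjoint A x)
    rw [adjoint_inner_left] at e2
    rw [add_apply, comp_apply, comp_apply, inner_add_right, adjoint_inner_right, Complex.add_re]
    exact congrArg₂ (· + ·) e1 e2
  have h4 := parallelogram_law_with_norm ℂ (reOp A x) (Complex.I • imOp A x)
  rw [← h1, ← h2, norm_smul, Complex.norm_I, one_mul] at h4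
  rw [h3]
  nlinarith

lemma norm_adjoint_comp_add_comp_adjoint_le_s10 [Nontrivial E] (A : E →L[ℂ] E) {M : ℝ}
    (hM : ∀ x, ‖x‖ = 1 → 2 * (‖reOp A x‖ ^ 2 + ‖imOp A x‖ ^ 2) ≤ M) :
    ‖adjoint A ∘L A + A ∘L adjoint A‖ ≤ M := by
  refine norm_le_of_abs_re_inner_le (fun x y => ?_) fun x hx => ?_
  · simp only [coe_coe, add_apply, comp_apply, inner_add_left, inner_add_right,
      adjoint_inner_left, adjoint_inner_right]
    rw [← adjoint_inner_right A (adjoint A x) y, ← adjoint_inner_left A (adjoint A y) x]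
  · rw [re_inner_adjoint_comp_add_comp_adjoint, abs_of_nonneg (by positivity)]
    exact hM x hx

lemma exists_unit_inner_reOp_imOp_eq_zero [Nontrivial E] (A : E →L[ℂ] E)
    (h : numRadius A = (1 / 2) * Real.sqrt ‖adjoint A ∘L A + A ∘L adjoint A‖) :
    (∃ z : E, ‖z‖ = 1 ∧ ⟪z, reOp A z⟫ = 0) ∧ ∃ z : E, ‖z‖ = 1 ∧ ⟪z, imOp A z⟫ = 0 := by
  set w := numRadius A with hw_def
  have hB := isSymmetric_reOp A
  have hC := isSymmetric_imOp A
  have hsq (x : E) (hx : ‖x‖ = 1) : (⟪x, A x⟫).re ^ 2 + (⟪x, A x⟫).im ^ 2 ≤ w ^ 2 := by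
    have := pow_le_pow_left₀ (norm_nonneg _) (norm_inner_le_numRadius A hx) 2
    rwa [Complex.sq_norm, Complex.normSq_apply, ← sq, ← sq] at this
  have hw0 : 0 ≤ w := by rw [h]; positivity
  have hBw : ‖reOp A‖ ≤ w := norm_le_of_abs_re_inner_le hB fun x hx => by
    rw [re_inner_reOp]
    exact abs_le_of_sq_le_sq (by nlinarith [hsq x hx, sq_nonneg (⟪x, A x⟫).im]) hw0
  have hCw : ‖imOp A‖ ≤ w := norm_le_of_abs_re_inner_le hC fun x hx => by
    rw [re_inner_imOp]
    exact abs_le_of_sq_le_sq (by nlinarith [hsq x hx, sq_nonneg (⟪x, A x⟫).re]) hw0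
  rcases hw0.eq_or_lt with h0 | hw
  · rw [← h0, norm_le_zero_iff] at hBw hCw
    obtain ⟨x, hx⟩ := exists_norm_eq E zero_le_one
    exact ⟨⟨x, hx, by simp [hBw]⟩, ⟨x, hx, by simp [hCw]⟩⟩
  have hs : (Real.sqrt 2 * w) ^ 2 = 2 * w ^ 2 := by
    rw [mul_pow, Real.sq_sqrt zero_le_two]
  have hs0 : 0 ≤ Real.sqrt 2 * w := by positivity
  have hadd : ‖reOp A + imOp A‖ ≤ Real.sqrt 2 * w :=
    norm_le_of_abs_re_inner_le (hB.add hC) fun x hx => by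
      rw [add_apply, inner_add_right, Complex.add_re, re_inner_reOp, re_inner_imOp]
      refine abs_le_of_sq_le_sq ?_ hs0
      nlinarith [hsq x hx, sq_nonneg ((⟪x, A x⟫).re - (⟪x, A x⟫).im)]
  have hsub : ‖reOp A - imOp A‖ ≤ Real.sqrt 2 * w :=
    norm_le_of_abs_re_inner_le (hB.sub hC) fun x hx => by
      rw [sub_apply, inner_sub_right, Complex.sub_re, re_inner_reOp, re_inner_imOp]
      refine abs_le_of_sq_le_sq ?_ hs0
      nlinarith [hsq x hx, sq_nonneg ((⟪x, A x⟫).re + (⟪x, A x⟫).im)]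
  have hS : ‖adjoint A ∘L A + A ∘L adjoint A‖ = 4 * w ^ 2 := by
    rw [h, mul_pow, Real.sq_sqrt (norm_nonneg _)]; ring
  have hex (n : ℕ) : ∃ x : E, ‖x‖ = 1 ∧
      2 * w ^ 2 - 1 / ((n : ℝ) + 1) ≤ ‖reOp A x‖ ^ 2 + ‖imOp A x‖ ^ 2 := by
    by_contra! hlt
    have := norm_adjoint_comp_add_comp_adjoint_le_s10 A
      (M := 2 * (2 * w ^ 2 - 1 / ((n : ℝ) + 1))) fun x hx => by linarith [hlt x hx]
    have hn : 0 < 1 / ((n : ℝ) + 1) := by positivity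
    linarith
  choose x hx hxl using hex
  have hlim : Tendsto (fun n => ‖reOp A (x n)‖ ^ 2 + ‖imOp A (x n)‖ ^ 2) atTop
      (𝓝 (2 * w ^ 2)) := by
    refine tendsto_of_tendsto_of_tendsto_of_le_of_le ?_ tendsto_const_nhds hxl fun n => ?_
    · simpa using (tendsto_one_div_add_atTop_nhds_zero_nat (𝕜 := ℝ)).const_sub (2 * w ^ 2)
    · have hb {T : E →L[ℂ] E} (hT : ‖T‖ ≤ w) : ‖T (x n)‖ ^ 2 ≤ w ^ 2 := by
        have := T.le_of_opNorm_le hT (x n)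
        rw [hx, mul_one] at this
        gcongr
      have := hb hBw
      have := hb hCw
      dsimp only; linarith
  exact ⟨exists_unit_inner_eq_zero_of_extremal hB hC hw hs hBw hCw hadd hsub hx hlim,
    exists_unit_inner_eq_zero_of_extremal hC hB hw hs hCw hBw (by rwa [add_comm])
      (by rwa [norm_sub_rev]) hx (by simpa only [add_comm] using hlim)⟩

end Helpers

/-- If `w(A) = (1/2)√‖A*A + AA*‖`, then `c(Re A) = 0` and `c(Im A) = 0`; in particular
there are sequences of unit vectors `(x n)`, `(y n)` with `|⟨Re(A)xₙ,xₙ⟩| → 0` and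
`|⟨Im(A)yₙ,yₙ⟩| → 0`. -/
theorem stmt10 (A : H →L[ℂ] H)
    (h : numRadius A = (1 / 2) * Real.sqrt ‖adjoint A ∘L A + A ∘L adjoint A‖) :
    crawford (reOp A) = 0 ∧ crawford (imOp A) = 0 ∧
      (∃ x : ℕ → H, (∀ n, ‖x n‖ = 1) ∧
        Tendsto (fun n => ‖(⟪x n, reOp A (x n)⟫ : ℂ)‖) atTop (𝓝 0)) ∧
      (∃ y : ℕ → H, (∀ n, ‖y n‖ = 1) ∧
        Tendsto (fun n => ‖(⟪y n, imOp A (y n)⟫ : ℂ)‖) atTop (𝓝 0)) := by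
  obtain ⟨⟨x, hx, hx0⟩, y, hy, hy0⟩ := exists_unit_inner_reOp_imOp_eq_zero A h
  refine ⟨crawford_eq_zero hx hx0, crawford_eq_zero hy hy0,
    ⟨fun _ => x, fun _ => hx, ?_⟩, ⟨fun _ => y, fun _ => hy, ?_⟩⟩
  · simp [hx0]
  · simp [hy0]
end
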